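/- Fix positive block sizes d : Fin m → ℕ and e : Fin n → ℕ, and let R = Σ i : Fin m, Fin (d i), C = Σ j : Fin n, Fin (e j). Let T, T' : Matrix R C ℂ both be orthoscalar with the same character (χᵒ, χᵉ), where χᵒ i > 0 for all i and χᵉ j > 0 for all j. Suppose there exist block-diagonal invertible matrices A : Matrix R R ℂ and B : Matrix C C ℂ with A * T = T' * B. Then there exist block-diagonal unitary matrices U : Matrix R R ℂ and V : Matrix C C ℂ with U * T = T' * V. (Two orthoscalar representations with the same character that are equivalent as representations are unitarily equivalent.) -/

import Mathlib

open Matrix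

/-- A square matrix indexed by a sigma type `Σ i, Fin (d i)` is block-diagonal if all
entries between different blocks vanish. -/
def IsBlockDiag {m : ℕ} {d : Fin m → ℕ}
    (A : Matrix (Σ i, Fin (d i)) (Σ i, Fin (d i)) ℂ) : Prop :=
  ∀ p q : Σ i, Fin (d i), p.1 ≠ q.1 → A p q = 0

/-- A matrix `T` is orthoscalar with character `(χo, χe)` if the rows within each
row block are orthogonal with common squared length `χo i`, and the columns within
each column block are orthogonal with common squared length `χe j`. -/
def IsOrthoscalar {m n : ℕ} {d : Fin m → ℕ} {e : Fin n → ℕ}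
    (T : Matrix (Σ i, Fin (d i)) (Σ j, Fin (e j)) ℂ)
    (χo : Fin m → ℝ) (χe : Fin n → ℝ) : Prop :=
  (∀ (i : Fin m) (s t : Fin (d i)),
      ∑ c : Σ j, Fin (e j), T ⟨i, s⟩ c * (starRingEnd ℂ) (T ⟨i, t⟩ c)
        = if s = t then (χo i : ℂ) else 0) ∧
  (∀ (j : Fin n) (s t : Fin (e j)),
      ∑ r : Σ i, Fin (d i), (starRingEnd ℂ) (T r ⟨j, s⟩) * T r ⟨j, t⟩
        = if s = t then (χe j : ℂ) else 0)

open scoped ComplexOrder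

theorem bd_mul {m : ℕ} {d : Fin m → ℕ}
    {A B : Matrix (Σ i, Fin (d i)) (Σ i, Fin (d i)) ℂ}
    (hA : IsBlockDiag A) (hB : IsBlockDiag B) : IsBlockDiag (A * B) := by
  intro p q hpq
  rw [Matrix.mul_apply]
  refine Finset.sum_eq_zero fun r _ => ?_
  by_cases h : p.1 = r.1
  · rw [hB r q (fun h' => hpq (h.trans h')), mul_zero]
  · rw [hA p r h, zero_mul]

theorem bd_star {m : ℕ} {d : Fin m → ℕ}
    {A : Matrix (Σ i, Fin (d i)) (Σ i, Fin (d i)) ℂ}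
    (hA : IsBlockDiag A) : IsBlockDiag Aᴴ := by
  intro p q hpq
  rw [Matrix.conjTranspose_apply, hA q p (Ne.symm hpq), star_zero]

theorem bd_aeval {m : ℕ} {d : Fin m → ℕ}
    {A : Matrix (Σ i, Fin (d i)) (Σ i, Fin (d i)) ℂ}
    (hA : IsBlockDiag A) (p : Polynomial ℝ) : IsBlockDiag (Polynomial.aeval A p) := by
  induction p using Polynomial.induction_on' with
  | add p q hp hq =>
    intro x y hxy
    rw [map_add, Matrix.add_apply, hp x y hxy, hq x y hxy, add_zero]
  | monomial k a =>
    have hk : IsBlockDiag (A ^ k) := by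
      induction k with
      | zero =>
        intro x y hxy
        rw [pow_zero, Matrix.one_apply_ne (fun h => hxy (by rw [h]))]
      | succ k ih => rw [pow_succ]; exact bd_mul ih hA
    intro x y hxy
    rw [Polynomial.aeval_monomial, ← Algebra.smul_def, Matrix.smul_apply, hk x y hxy, smul_zero]

theorem os_star {m n : ℕ} {d : Fin m → ℕ} {e : Fin n → ℕ}
    {T : Matrix (Σ i, Fin (d i)) (Σ j, Fin (e j)) ℂ}
    {χo : Fin m → ℝ} {χe : Fin n → ℝ} (h : IsOrthoscalar T χo χe) :
    IsOrthoscalar Tᴴ χe χo := by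
  refine ⟨fun j s t => ?_, fun i s t => ?_⟩
  · rw [← h.2 j s t]
    simp [Matrix.conjTranspose_apply]
  · rw [← h.1 i s t]
    simp [Matrix.conjTranspose_apply]

theorem os_trace {m n : ℕ} {d : Fin m → ℕ} {e : Fin n → ℕ}
    {T : Matrix (Σ i, Fin (d i)) (Σ j, Fin (e j)) ℂ}
    {χo : Fin m → ℝ} {χe : Fin n → ℝ} (h : IsOrthoscalar T χo χe)
    {M : Matrix (Σ i, Fin (d i)) (Σ i, Fin (d i)) ℂ} (hM : IsBlockDiag M) :
    trace (M * (T * Tᴴ)) = trace (M * diagonal (fun p => (χo p.1 : ℂ))) := by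
  simp only [Matrix.trace, Matrix.diag_apply]
  refine Finset.sum_congr rfl fun p _ => ?_
  rw [Matrix.mul_apply, Matrix.mul_apply]
  refine Finset.sum_congr rfl fun q _ => ?_
  by_cases hpq : p.1 = q.1
  · congr 1
    obtain ⟨i, s⟩ := p
    obtain ⟨j, t⟩ := q
    dsimp only at hpq
    subst hpq
    have := h.1 i t s
    rw [Matrix.mul_apply, Matrix.diagonal_apply]
    simp only [Matrix.conjTranspose_apply]
    refine Eq.trans this ?_
    simp
  · rw [hM p q hpq, zero_mul, zero_mul]

/-- The key trace identity. -/
theorem os_trace_eq {m n : ℕ} {d : Fin m → ℕ} {e : Fin n → ℕ}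
    {T T' : Matrix (Σ i, Fin (d i)) (Σ j, Fin (e j)) ℂ}
    {χo : Fin m → ℝ} {χe : Fin n → ℝ} (h : IsOrthoscalar T χo χe)
    (h' : IsOrthoscalar T' χo χe)
    {A : Matrix (Σ i, Fin (d i)) (Σ i, Fin (d i)) ℂ} (hA : IsBlockDiag A) :
    trace (A * Aᴴ * (T' * T'ᴴ)) = trace (Aᴴ * A * (T * Tᴴ)) := by
  rw [os_trace h' (bd_mul hA (bd_star hA)), os_trace h (bd_mul (bd_star hA) hA)]
  have hc : A * diagonal (fun p => (χo p.1 : ℂ)) = diagonal (fun p => (χo p.1 : ℂ)) * A := by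
    ext p q
    rw [Matrix.mul_diagonal, Matrix.diagonal_mul]
    by_cases hpq : p.1 = q.1
    · rw [hpq, mul_comm]
    · rw [hA p q hpq, zero_mul, mul_zero]
  rw [Matrix.mul_assoc Aᴴ, hc, ← Matrix.mul_assoc, Matrix.trace_mul_comm (Aᴴ * _), ← Matrix.mul_assoc,
    Matrix.trace_mul_comm (A * Aᴴ)]

theorem aeval_inv_sqrt {N : Type*} [Fintype N] [DecidableEq N] {H : Matrix N N ℂ}
    (hH : H.PosDef) (p : Polynomial ℝ)
    (hp : ∀ x ∈ spectrum ℝ H, p.eval x = (Real.sqrt x)⁻¹) :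
    (Polynomial.aeval H p)ᴴ = Polynomial.aeval H p ∧
      Polynomial.aeval H p * H * Polynomial.aeval H p = 1 := by
  have hsa : IsSelfAdjoint H := hH.1
  constructor
  · rw [← cfc_polynomial p H hsa]
    exact (cfc_predicate (R := ℝ) p.eval H : IsSelfAdjoint _)
  · have h1 : Polynomial.aeval H p * H * Polynomial.aeval H p
        = Polynomial.aeval H (p * Polynomial.X * p) := by simp
    rw [h1, ← cfc_polynomial _ H hsa, ← cfc_one ℝ H hsa]
    refine cfc_congr fun x hx => ?_
    have hx0 : 0 < x := by
      rw [hH.1.spectrum_real_eq_range_eigenvalues] at hx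
      obtain ⟨i, rfl⟩ := hx
      exact hH.eigenvalues_pos i
    have hs : 0 < Real.sqrt x := Real.sqrt_pos.2 hx0
    simp only [Polynomial.eval_mul, Polynomial.eval_X, hp x hx, Pi.one_apply]
    field_simp
    rw [Real.sq_sqrt hx0.le]

theorem aeval_intertwine {N M : Type*} [Fintype N] [DecidableEq N] [Fintype M] [DecidableEq M]
    {H : Matrix N N ℂ} {K : Matrix M M ℂ} {T : Matrix N M ℂ} (h : H * T = T * K)
    (p : Polynomial ℝ) : Polynomial.aeval H p * T = T * Polynomial.aeval K p := by
  induction p using Polynomial.induction_on' with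
  | add p q hp hq => rw [map_add, map_add, Matrix.add_mul, Matrix.mul_add, hp, hq]
  | monomial k a =>
    have hk : H ^ k * T = T * K ^ k := by
      induction k with
      | zero => simp
      | succ k ih => rw [pow_succ, Matrix.mul_assoc, h, ← Matrix.mul_assoc, ih, pow_succ,
          Matrix.mul_assoc]
    rw [Polynomial.aeval_monomial, Polynomial.aeval_monomial, ← Algebra.smul_def,
      ← Algebra.smul_def, Matrix.smul_mul, Matrix.mul_smul, hk]

/-- Two orthoscalar representations with the same (positive) character that are
equivalent in the category of all representations are unitarily equivalent. -/
theorem orthoscalar_equiv_iff_unitarily_equiv (m n : ℕ)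
    (d : Fin m → ℕ) (e : Fin n → ℕ)
    (hd : ∀ i, 0 < d i) (he : ∀ j, 0 < e j)
    (T T' : Matrix (Σ i, Fin (d i)) (Σ j, Fin (e j)) ℂ)
    (χo : Fin m → ℝ) (χe : Fin n → ℝ)
    (hχo : ∀ i, 0 < χo i) (hχe : ∀ j, 0 < χe j)
    (hT : IsOrthoscalar T χo χe) (hT' : IsOrthoscalar T' χo χe)
    (h : ∃ (A : Matrix (Σ i, Fin (d i)) (Σ i, Fin (d i)) ℂ)
           (B : Matrix (Σ j, Fin (e j)) (Σ j, Fin (e j)) ℂ),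
           IsBlockDiag A ∧ IsBlockDiag B ∧ IsUnit A ∧ IsUnit B ∧ A * T = T' * B) :
    ∃ (U : Matrix (Σ i, Fin (d i)) (Σ i, Fin (d i)) ℂ)
      (V : Matrix (Σ j, Fin (e j)) (Σ j, Fin (e j)) ℂ),
      IsBlockDiag U ∧ IsBlockDiag V ∧
      U * Uᴴ = 1 ∧ Uᴴ * U = 1 ∧ V * Vᴴ = 1 ∧ Vᴴ * V = 1 ∧
      U * T = T' * V := by
  obtain ⟨A, B, hA, hB, uA, uB, hAB⟩ := h
  have hAB' : Tᴴ * Aᴴ = Bᴴ * T'ᴴ := by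
    rw [← Matrix.conjTranspose_mul, hAB, Matrix.conjTranspose_mul]
  have t1 := os_trace_eq hT hT' hA
  have t2 := os_trace_eq (os_star hT) (os_star hT') hB
  rw [Matrix.conjTranspose_conjTranspose, Matrix.conjTranspose_conjTranspose] at t2
  have t3 : trace (B * Bᴴ * (T'ᴴ * T')) = trace (Aᴴ * A * (T * Tᴴ)) := by
    calc trace (B * Bᴴ * (T'ᴴ * T')) = trace (B * (Bᴴ * T'ᴴ) * T') := by
          simp only [Matrix.mul_assoc]
      _ = trace (T' * B * Tᴴ * Aᴴ) := by
          rw [← hAB', Matrix.trace_mul_comm]; simp only [Matrix.mul_assoc]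
      _ = trace (Aᴴ * A * (T * Tᴴ)) := by
          rw [← hAB, Matrix.trace_mul_comm]; simp only [Matrix.mul_assoc]
  have key : Aᴴ * T' = T * Bᴴ := by
    rw [← sub_eq_zero, ← Matrix.trace_mul_conjTranspose_self_eq_zero_iff]
    have e1 : trace (Aᴴ * T' * (T'ᴴ * A)) = trace (Aᴴ * A * (T * Tᴴ)) := by
      rw [← t1, ← Matrix.mul_assoc, Matrix.trace_mul_comm]; simp only [Matrix.mul_assoc]
    have e2 : trace (Aᴴ * T' * (B * Tᴴ)) = trace (Aᴴ * A * (T * Tᴴ)) := by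
      have : Aᴴ * T' * (B * Tᴴ) = Aᴴ * (T' * B) * Tᴴ := by simp only [Matrix.mul_assoc]
      rw [this, ← hAB]; simp only [Matrix.mul_assoc]
    have e3 : trace (T * Bᴴ * (T'ᴴ * A)) = trace (Aᴴ * A * (T * Tᴴ)) := by
      have : T * Bᴴ * (T'ᴴ * A) = T * (Bᴴ * T'ᴴ) * A := by simp only [Matrix.mul_assoc]
      rw [this, ← hAB', Matrix.trace_mul_comm, ← Matrix.mul_assoc, Matrix.mul_assoc Aᴴ,
        ← Matrix.mul_assoc, ← Matrix.mul_assoc, Matrix.trace_mul_comm]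
      simp only [Matrix.mul_assoc]
    have e4 : trace (T * Bᴴ * (B * Tᴴ)) = trace (Aᴴ * A * (T * Tᴴ)) := by
      rw [← t3, t2, ← Matrix.mul_assoc, Matrix.trace_mul_comm, Matrix.mul_assoc T,
        ← Matrix.mul_assoc, Matrix.trace_mul_comm]
    rw [Matrix.conjTranspose_sub, Matrix.conjTranspose_mul, Matrix.conjTranspose_mul,
      Matrix.conjTranspose_conjTranspose, Matrix.conjTranspose_conjTranspose, Matrix.sub_mul,
      Matrix.mul_sub, Matrix.mul_sub, Matrix.trace_sub, Matrix.trace_sub, Matrix.trace_sub,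
      e1, e2, e3, e4]
    ring
  have hHK : (Aᴴ * A) * T = T * (Bᴴ * B) := by
    rw [Matrix.mul_assoc, hAB, ← Matrix.mul_assoc, key, Matrix.mul_assoc]
  have pA : (Aᴴ * A).PosDef :=
    Matrix.PosDef.conjTranspose_mul_self A (Matrix.mulVec_injective_of_isUnit uA)
  have pB : (Bᴴ * B).PosDef :=
    Matrix.PosDef.conjTranspose_mul_self B (Matrix.mulVec_injective_of_isUnit uB)
  obtain ⟨p, hp⟩ : ∃ p : Polynomial ℝ, ∀ x ∈ spectrum ℝ (Aᴴ * A) ∪ spectrum ℝ (Bᴴ * B),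
      p.eval x = (Real.sqrt x)⁻¹ := by
    have hf : (spectrum ℝ (Aᴴ * A) ∪ spectrum ℝ (Bᴴ * B)).Finite := by
      rw [pA.1.spectrum_real_eq_range_eigenvalues, pB.1.spectrum_real_eq_range_eigenvalues]
      exact (Set.finite_range _).union (Set.finite_range _)
    refine ⟨Lagrange.interpolate hf.toFinset id (fun x => (Real.sqrt x)⁻¹), fun x hx => ?_⟩
    exact Lagrange.eval_interpolate_at_node (v := id) (fun x => (Real.sqrt x)⁻¹)
      (Set.injOn_id _) (hf.mem_toFinset.2 hx)
  obtain ⟨sA, oA⟩ := aeval_inv_sqrt pA p (fun x hx => hp x (Or.inl hx))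
  obtain ⟨sB, oB⟩ := aeval_inv_sqrt pB p (fun x hx => hp x (Or.inr hx))
  have hI := aeval_intertwine hHK p
  have bA := bd_aeval (bd_mul (bd_star hA) hA) p
  have bB := bd_aeval (bd_mul (bd_star hB) hB) p
  generalize Polynomial.aeval (Aᴴ * A) p = P at *
  generalize Polynomial.aeval (Bᴴ * B) p = Q at *
  have uU : (A * P)ᴴ * (A * P) = 1 := by
    rw [Matrix.conjTranspose_mul, sA, ← oA]; simp only [Matrix.mul_assoc]
  have uV : (B * Q)ᴴ * (B * Q) = 1 := by
    rw [Matrix.conjTranspose_mul, sB, ← oB]; simp only [Matrix.mul_assoc]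
  refine ⟨A * P, B * Q, bd_mul hA bA, bd_mul hB bB, mul_eq_one_comm.1 uU, uU,
    mul_eq_one_comm.1 uV, uV, ?_⟩
  rw [Matrix.mul_assoc, hI, ← Matrix.mul_assoc, hAB, Matrix.mul_assoc]
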